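/- Let λ be a partition of n with N parts and let P_λ ∈ ℤ[x] be the polynomial such that P_λ(|F|) equals the number of strictly upper triangular n×n matrices over F of Jordan type λ for every finite field F. Then the multiplicity of 1 as a root of P_λ is exactly n − N; that is, (x−1)^{n−N} divides P_λ(x) in ℤ[x] but (x−1)^{n−N+1} does not. -/

import Mathlib

open Polynomial

/-- `f` represents the partition `λ₁ ≥ λ₂ ≥ … ≥ λ_N > 0` of `n`:
`f i = λᵢ` for `1 ≤ i ≤ N` and `f i = 0` for `i > N`. -/
def IsPartitionFun (f : ℕ → ℕ) (n N : ℕ) : Prop :=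
  (∀ i j, i ≤ j → f j ≤ f i) ∧ (∀ i, 1 ≤ i → (0 < f i ↔ i ≤ N)) ∧
    ∑ i ∈ Finset.Icc 1 N, f i = n

/-- `A` is strictly upper triangular: `A i j = 0` whenever `j ≤ i`. -/
def StrictUpper {m : ℕ} {F : Type*} [Zero F] (A : Matrix (Fin m) (Fin m) F) : Prop :=
  ∀ i j : Fin m, (j : ℕ) ≤ (i : ℕ) → A i j = 0

/-- `A` has Jordan type `λ`: `rank (A ^ k) = Σᵢ max (λᵢ - k) 0` for every `k ≥ 0`. -/
def HasJordanType {m : ℕ} {F : Type*} [Field F] (A : Matrix (Fin m) (Fin m) F)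
    (f : ℕ → ℕ) (N : ℕ) : Prop :=
  ∀ k : ℕ, (A ^ k).rank = ∑ i ∈ Finset.Icc 1 N, (f i - k)

/-- The number of strictly upper triangular `m × m` matrices over `F` of Jordan type `λ`. -/
noncomputable def jordanCount (m : ℕ) (f : ℕ → ℕ) (N : ℕ)
    (F : Type) [Field F] [Fintype F] : ℕ :=
  Nat.card {A : Matrix (Fin m) (Fin m) F // StrictUpper A ∧ HasJordanType A f N}

/-- `dualPart f N j = λ'_j`, the number of parts of `λ` that are `≥ j`. -/
def dualPart (f : ℕ → ℕ) (N j : ℕ) : ℕ :=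
  ((Finset.Icc 1 N).filter fun i => j ≤ f i).card

/-- `alphaCount f N k = α_k`, the number of parts of `λ` equal to `k`. -/
def alphaCount (f : ℕ → ℕ) (N k : ℕ) : ℕ :=
  ((Finset.Icc 1 N).filter fun i => f i = k).card

/-- The rows containing a removable cell of the Young diagram of `λ`:
rows `1 ≤ i ≤ N` with `i = N` or `λ_{i+1} < λᵢ` (for `i = N` the condition
`f (i+1) < f i` holds automatically since `f (N+1) = 0 < f N`). -/
def removables (f : ℕ → ℕ) (N : ℕ) : Finset ℕ :=
  (Finset.Icc 1 N).filter fun i => f (i + 1) < f i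

/-- The matrix `A` bordered by the last column `v` and a zero last row. -/
def borderCol {m : ℕ} {F : Type} [Field F] (A : Matrix (Fin m) (Fin m) F) (v : Fin m → F) :
    Matrix (Fin (m + 1)) (Fin (m + 1)) F :=
  Matrix.reindexAlgEquiv F F finSumFinEquiv
    (Matrix.fromBlocks A (Matrix.replicateCol (Fin 1) v) 0 0)

/-- The vectors `v` with `A ^ k v` in the range of `A ^ (k + 1)`, that is `ker A ^ k + im A`. -/
def powComap {m : ℕ} {F : Type} [Field F] (A : Matrix (Fin m) (Fin m) F) (k : ℕ) :
    Submodule F (Fin m → F) :=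
  (LinearMap.range (A ^ (k + 1)).mulVecLin).comap (A ^ k).mulVecLin

/-- `A` has `d k` Jordan blocks of size larger than `k` at the eigenvalue `0`. -/
def HasDualType {m : ℕ} {F : Type} [Field F] (A : Matrix (Fin m) (Fin m) F) (d : ℕ → ℕ) : Prop :=
  ∀ k, (A ^ k).rank = (A ^ (k + 1)).rank + d k

section LinearAlgebra

variable {m : ℕ} {F : Type} [Field F] (A : Matrix (Fin m) (Fin m) F) (v : Fin m → F)

theorem mem_powComap (k : ℕ) :
    v ∈ powComap A k ↔
      (A ^ k).mulVec v ∈ Submodule.span F (Set.range (A ^ (k + 1)).col) := by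
  rw [← Matrix.range_mulVecLin]; rfl

theorem powComap_le_succ (k : ℕ) : powComap A k ≤ powComap A (k + 1) := by
  rintro v ⟨w, hw⟩
  refine ⟨w, ?_⟩
  simp only [Matrix.mulVecLin_apply] at hw ⊢
  rw [pow_succ' A (k + 1), ← Matrix.mulVec_mulVec, hw, Matrix.mulVec_mulVec, ← pow_succ']

theorem powComap_mono : Monotone (powComap A) := monotone_nat_of_le_succ (powComap_le_succ A)

theorem finrank_powComap (k : ℕ) :
    Module.finrank F (powComap A k) + (A ^ k).rank = m + (A ^ (k + 1)).rank := by
  set g := (A ^ k).mulVecLin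
  set S := LinearMap.range (A ^ (k + 1)).mulVecLin with hS
  have hle : S ≤ LinearMap.range g := by
    rintro _ ⟨w, rfl⟩
    refine ⟨A.mulVec w, ?_⟩
    simp [g, pow_succ]
  have h1 := LinearMap.finrank_range_add_finrank_ker g
  have h2 := LinearMap.finrank_range_add_finrank_ker (g.domRestrict (S.comap g))
  have h3 : LinearMap.range (g.domRestrict (S.comap g)) = S := by
    rw [LinearMap.range_domRestrict, Submodule.map_comap_eq, inf_eq_right.2 hle]
  have h4 : Module.finrank F (LinearMap.ker (g.domRestrict (S.comap g))) =
      Module.finrank F (LinearMap.ker g) := by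
    rw [LinearMap.ker_domRestrict]
    refine (Submodule.comapSubtypeEquivOfLe ?_).finrank_eq
    intro x hx
    rw [Submodule.mem_comap, LinearMap.mem_ker.1 hx]
    exact S.zero_mem
  rw [h3, h4] at h2
  have h5 : powComap A k = S.comap g := rfl
  rw [Module.finrank_fin_fun] at h1
  have h6 : (A ^ k).rank = Module.finrank F (LinearMap.range g) := rfl
  have h7 : (A ^ (k + 1)).rank = Module.finrank F S := rfl
  rw [h5, h6, h7]
  omega

theorem HasDualType.finrank_powComap {A : Matrix (Fin m) (Fin m) F} {d : ℕ → ℕ}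
    (h : HasDualType A d) (k : ℕ) : Module.finrank F (powComap A k) + d k = m := by
  have h1 := _root_.finrank_powComap A k
  have h2 := h k
  omega

theorem HasDualType.antitone {A : Matrix (Fin m) (Fin m) F} {d : ℕ → ℕ}
    (h : HasDualType A d) : Antitone d := by
  refine antitone_nat_of_succ_le fun k => ?_
  have h1 := h.finrank_powComap k
  have h2 := h.finrank_powComap (k + 1)
  have h3 := Submodule.finrank_mono (powComap_le_succ A k)
  omega

theorem exists_mem_powComap : ∃ k, v ∈ powComap A k := by
  by_contra! h
  have hlt : ∀ k, (A ^ (k + 1)).rank < (A ^ k).rank := by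
    intro k
    have h1 := finrank_powComap A k
    have h2 : Module.finrank F (powComap A k) < Module.finrank F (Fin m → F) :=
      Submodule.finrank_lt fun ht => h k (ht ▸ Submodule.mem_top)
    rw [Module.finrank_fin_fun] at h2
    omega
  exact not_strictAnti_of_wellFoundedLT (fun k => (A ^ k).rank) (strictAnti_nat_of_succ_lt hlt)

theorem rank_fromBlocks_zero_zero {n p : Type} [Fintype n] [Fintype p] [DecidableEq n]
    [DecidableEq p] (C : Matrix (Fin m) n F) (D : Matrix (Fin m) p F) :
    (Matrix.fromBlocks C D (0 : Matrix p n F) 0).rank = (Matrix.fromCols C D).rank := by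
  apply le_antisymm
  · have : Matrix.fromBlocks C D (0 : Matrix p n F) 0 =
        Matrix.fromRows (1 : Matrix (Fin m) (Fin m) F) 0 * Matrix.fromCols C D := by
      rw [Matrix.fromRows_mul_fromCols]; simp
    rw [this]
    exact Matrix.rank_mul_le_right _ _
  · have : Matrix.fromCols C D = Matrix.fromCols (1 : Matrix (Fin m) (Fin m) F)
        (0 : Matrix (Fin m) p F) *
        Matrix.fromBlocks C D (0 : Matrix p n F) 0 := by
      rw [Matrix.fromCols_mul_fromBlocks]; simp
    rw [this]
    exact Matrix.rank_mul_le_right _ _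

open Classical in
theorem finrank_sup_span_singleton {V : Type} [AddCommGroup V] [Module F V]
    [FiniteDimensional F V] (S : Submodule F V) (x : V) :
    Module.finrank F ↥(S ⊔ Submodule.span F {x}) =
      Module.finrank F S + if x ∈ S then 0 else 1 := by
  split_ifs with h
  · rw [sup_eq_left.2 ((Submodule.span_singleton_le_iff_mem _ _).2 h), add_zero]
  · have hx : x ≠ 0 := fun h0 => h (h0 ▸ S.zero_mem)
    have h1 := Submodule.finrank_sup_add_finrank_inf_eq S (Submodule.span F {x})
    rw [((Submodule.disjoint_span_singleton' hx).2 h).eq_bot, finrank_bot,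
      finrank_span_singleton hx] at h1
    omega

open Classical in
theorem rank_fromCols_replicateCol (C : Matrix (Fin m) (Fin m) F) (x : Fin m → F) :
    (Matrix.fromCols C (Matrix.replicateCol (Fin 1) x)).rank =
      C.rank + if x ∈ Submodule.span F (Set.range C.col) then 0 else 1 := by
  have hcols : Set.range (Matrix.fromCols C (Matrix.replicateCol (Fin 1) x)).col =
      Set.range C.col ∪ {x} := by
    ext y
    rw [Set.mem_range, Sum.exists, Set.mem_union, Set.mem_singleton_iff]
    refine or_congr Iff.rfl ⟨?_, fun h => ⟨0, ?_⟩⟩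
    · rintro ⟨_, rfl⟩
      rfl
    · rw [h]; rfl
  rw [Matrix.rank_eq_finrank_span_cols, Matrix.rank_eq_finrank_span_cols, hcols,
    Submodule.span_union, finrank_sup_span_singleton]

theorem fromBlocks_pow_succ (k : ℕ) :
    (Matrix.fromBlocks A (Matrix.replicateCol (Fin 1) v) 0 0 :
      Matrix (Fin m ⊕ Fin 1) (Fin m ⊕ Fin 1) F) ^ (k + 1) =
      Matrix.fromBlocks (A ^ (k + 1)) (Matrix.replicateCol (Fin 1) ((A ^ k).mulVec v)) 0 0 := by
  induction k with
  | zero => simp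
  | succ k ih =>
    rw [pow_succ', ih, Matrix.fromBlocks_multiply]
    simp [pow_succ' A, ← Matrix.replicateCol_mulVec]

open Classical in
theorem rank_borderCol_pow_succ (k : ℕ) :
    (borderCol A v ^ (k + 1)).rank =
      (A ^ (k + 1)).rank + if v ∈ powComap A k then 0 else 1 := by
  rw [borderCol, ← map_pow, Matrix.coe_reindexAlgEquiv, Matrix.rank_reindex,
    fromBlocks_pow_succ, rank_fromBlocks_zero_zero, rank_fromCols_replicateCol]
  simp only [mem_powComap]

open Classical in
/-- The length of the Jordan block created or enlarged by bordering `A` with `v`, minus one. -/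
noncomputable def borderIndex : ℕ := Nat.find (exists_mem_powComap A v)

theorem mem_powComap_iff_borderIndex_le (k : ℕ) : v ∈ powComap A k ↔ borderIndex A v ≤ k := by
  classical
  constructor
  · exact fun h => Nat.find_min' _ h
  · exact fun h => powComap_mono A h (Nat.find_spec (exists_mem_powComap A v))

theorem rank_borderCol_pow (k : ℕ) :
    (borderCol A v ^ k).rank = (A ^ k).rank + if borderIndex A v < k then 0 else 1 := by
  cases k with
  | zero => simp
  | succ k =>
    rw [rank_borderCol_pow_succ]
    simp only [mem_powComap_iff_borderIndex_le, Nat.lt_succ_iff]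

theorem hasDualType_borderCol (c : ℕ → ℕ) :
    HasDualType (borderCol A v) c ↔ 1 ≤ c (borderIndex A v) ∧
      HasDualType A (Function.update c (borderIndex A v) (c (borderIndex A v) - 1)) := by
  set j := borderIndex A v with hj
  simp only [HasDualType, rank_borderCol_pow, ← hj, Function.update_apply]
  constructor
  · intro h
    have h1 := finrank_powComap A j
    have h2 : Module.finrank F (powComap A j) ≤ m := by
      simpa using Submodule.finrank_le (powComap A j)
    constructor
    · have := h j
      simp at this
      omega
    · intro k
      have := h k
      split_ifs at this ⊢ <;> subst_vars <;> omega
  · rintro ⟨h0, h⟩ k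
    have := h k
    split_ifs at this ⊢ <;> subst_vars <;> omega

theorem strictUpper_borderCol : StrictUpper (borderCol A v) ↔ StrictUpper A := by
  constructor
  · intro h i j hij
    have := h (Fin.castAdd 1 i) (Fin.castAdd 1 j) (by simpa using hij)
    simpa [borderCol, Matrix.coe_reindexAlgEquiv] using this
  · intro h i j hij
    obtain ⟨i, rfl⟩ := finSumFinEquiv.surjective i
    obtain ⟨j, rfl⟩ := finSumFinEquiv.surjective j
    rcases i with i | i <;> rcases j with j | j <;>
      simp [borderCol, Matrix.coe_reindexAlgEquiv] at hij ⊢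
    · exact h i j hij
    · omega

theorem borderCol_injective :
    Function.Injective fun p : Matrix (Fin m) (Fin m) F × (Fin m → F) => borderCol p.1 p.2 := by
  rintro ⟨A, v⟩ ⟨B, w⟩ h
  have h' := (Matrix.reindexAlgEquiv F F finSumFinEquiv).injective h
  obtain ⟨h1, h2, -, -⟩ := Matrix.fromBlocks_inj.1 h'
  exact Prod.ext h1 (Matrix.replicateCol_injective h2)

theorem StrictUpper.exists_borderCol {B : Matrix (Fin (m + 1)) (Fin (m + 1)) F}
    (hB : StrictUpper B) : ∃ A v, borderCol A v = B := by
  refine ⟨B.submatrix Fin.castSucc Fin.castSucc, fun i => B i.castSucc (Fin.last m), ?_⟩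
  ext i j
  obtain ⟨i, rfl⟩ := finSumFinEquiv.surjective i
  obtain ⟨j, rfl⟩ := finSumFinEquiv.surjective j
  have hlast : ∀ i : Fin 1, Fin.natAdd m i = Fin.last m := fun i => by ext; simp
  rcases i with i | i <;> rcases j with j | j <;>
    simp [borderCol, Matrix.coe_reindexAlgEquiv]
  · rfl
  · rw [hlast]; rfl
  · exact (hB _ _ (by simp)).symm
  · exact (hB _ _ (by simp)).symm

end LinearAlgebra

section Counting

/-- The number of strictly upper triangular matrices with `d k` Jordan blocks of size larger
than `k` for every `k`. -/
noncomputable def dualCount (m : ℕ) (d : ℕ → ℕ) (F : Type) [Field F] : ℕ :=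
  Nat.card {A : Matrix (Fin m) (Fin m) F // StrictUpper A ∧ HasDualType A d}

/-- The polynomial counting the vectors whose addition to a matrix as a last column
changes its dual type by a cell in column `j`, resulting in the dual type `c`. -/
noncomputable def borderPoly (m : ℕ) (c : ℕ → ℕ) (j : ℕ) : ℤ[X] :=
  X ^ (m + 1 - c j) - if j = 0 then 0 else X ^ (m - c (j - 1))

theorem dualCount_eq_zero {m : ℕ} {F : Type} [Field F] {d : ℕ → ℕ} (hd : ¬ Antitone d) :
    dualCount m d F = 0 := by
  have : IsEmpty {A : Matrix (Fin m) (Fin m) F // StrictUpper A ∧ HasDualType A d} :=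
    ⟨fun A => hd A.2.2.antitone⟩
  exact Nat.card_of_isEmpty

variable {m : ℕ} {F : Type} [Field F] [Fintype F]

open Classical in
theorem card_borderIndex_eq (A : Matrix (Fin m) (Fin m) F) (c : ℕ → ℕ) (j : ℕ) (hj : 1 ≤ c j)
    (hA : HasDualType A (Function.update c j (c j - 1))) :
    ((Finset.univ.filter fun v : Fin m → F => borderIndex A v = j).card : ℤ) =
      (borderPoly m c j).eval (Fintype.card F : ℤ) := by
  have hcard : ∀ k, (Finset.univ.filter fun v : Fin m → F => borderIndex A v ≤ k).card =
      Fintype.card F ^ Module.finrank F (powComap A k) := by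
    intro k
    rw [← Module.card_eq_pow_finrank (K := F) (V := powComap A k), ← Fintype.card_subtype]
    exact Fintype.card_congr (Equiv.subtypeEquivRight fun v =>
      (mem_powComap_iff_borderIndex_le A v k).symm)
  have hdim := hA.finrank_powComap j
  rw [Function.update_self] at hdim
  rcases j with _ | j
  · have := hcard 0
    simp only [Nat.le_zero] at this
    rw [this, borderPoly, show Module.finrank F (powComap A 0) = m + 1 - c 0 by omega]
    simp
  · have hdim' := hA.finrank_powComap j
    rw [Function.update_of_ne (by omega)] at hdim'
    have hsplit : (Finset.univ.filter fun v : Fin m → F => borderIndex A v ≤ j + 1) =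
        (Finset.univ.filter fun v : Fin m → F => borderIndex A v ≤ j) ∪
        (Finset.univ.filter fun v : Fin m → F => borderIndex A v = j + 1) := by
      ext v; simp; omega
    have hdisj : Disjoint (Finset.univ.filter fun v : Fin m → F => borderIndex A v ≤ j)
        (Finset.univ.filter fun v : Fin m → F => borderIndex A v = j + 1) := by
      rw [Finset.disjoint_filter]; intro v _ h; omega
    have h1 := hcard (j + 1)
    rw [hsplit, Finset.card_union_of_disjoint hdisj, hcard j,
      show Module.finrank F (powComap A (j + 1)) = m + 1 - c (j + 1) by omega,
      show Module.finrank F (powComap A j) = m - c j by omega] at h1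
    simp only [borderPoly, Nat.add_sub_cancel, Nat.add_eq_zero_iff, one_ne_zero, and_false, if_false,
      eval_sub, eval_pow, eval_X]
    rw [eq_sub_iff_add_eq, add_comm]
    exact_mod_cast h1

open Classical in
theorem dualCount_succ (c : ℕ → ℕ) (L : ℕ) (hL : ∀ k, L ≤ k → c k = 0) :
    (dualCount (m + 1) c F : ℤ) = ∑ j ∈ Finset.range L, if 1 ≤ c j then
      (borderPoly m c j).eval (Fintype.card F : ℤ) *
        dualCount m (Function.update c j (c j - 1)) F else 0 := by
  have hbij : dualCount (m + 1) c F = (Finset.univ.filter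
      fun p : Matrix (Fin m) (Fin m) F × (Fin m → F) =>
        StrictUpper p.1 ∧ HasDualType (borderCol p.1 p.2) c).card := by
    rw [dualCount, ← Fintype.card_subtype, ← Nat.card_eq_fintype_card]
    symm
    refine Nat.card_congr (Equiv.ofBijective
      (fun p => ⟨borderCol p.1.1 p.1.2, (strictUpper_borderCol _ _).2 p.2.1, p.2.2⟩) ⟨?_, ?_⟩)
    · intro p p' h
      exact Subtype.ext (borderCol_injective (Subtype.ext_iff.1 h))
    · rintro ⟨B, hB, hc⟩
      obtain ⟨A, v, rfl⟩ := hB.exists_borderCol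
      exact ⟨⟨(A, v), (strictUpper_borderCol A v).1 hB, hc⟩, rfl⟩
  rw [hbij, Finset.card_eq_sum_card_fiberwise (f := fun p => borderIndex p.1 p.2)
    (t := Finset.range L)]
  · push_cast
    refine Finset.sum_congr rfl fun j _ => ?_
    rw [Finset.filter_filter]
    split_ifs with hj
    · rw [dualCount, Nat.card_eq_fintype_card, Fintype.card_subtype]
      rw [Finset.card_eq_sum_card_fiberwise (f := Prod.fst) (t := Finset.univ.filter
        fun A : Matrix (Fin m) (Fin m) F => StrictUpper A ∧
          HasDualType A (Function.update c j (c j - 1)))]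
      · push_cast
        rw [mul_comm, ← nsmul_eq_mul]
        refine Finset.sum_eq_card_nsmul fun A hA => ?_
        obtain ⟨hA1, hA2⟩ := (Finset.mem_filter.1 hA).2
        rw [← card_borderIndex_eq A c j hj hA2]
        congr 1
        refine (Finset.card_bij (fun v _ => (A, v)) ?_ ?_ ?_).symm
        · intro v hv
          simp only [Finset.mem_filter, Finset.mem_univ, true_and, and_true] at hv ⊢
          refine ⟨⟨hA1, ?_⟩, hv⟩
          rw [hasDualType_borderCol, hv]
          exact ⟨hj, hA2⟩
        · intro v _ w _ h
          exact (Prod.ext_iff.1 h).2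
        · rintro ⟨B, v⟩ h
          simp only [Finset.mem_filter, Finset.mem_univ, true_and] at h
          obtain ⟨h1, rfl⟩ := h
          exact ⟨v, by simpa using h1.2, rfl⟩
      · rintro ⟨B, v⟩ h
        simp only [Finset.coe_filter, Finset.mem_univ, true_and, Set.mem_ofPred_eq] at h ⊢
        obtain ⟨⟨h1, h2⟩, h3⟩ := h
        rw [hasDualType_borderCol, h3] at h2
        exact ⟨h1, h2.2⟩
    · rw [Nat.cast_eq_zero, Finset.card_eq_zero, Finset.filter_eq_empty_iff]
      rintro ⟨A, v⟩ _ ⟨⟨_, h2⟩, h3⟩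
      rw [hasDualType_borderCol, h3] at h2
      exact hj h2.1
  · rintro ⟨A, v⟩ h
    simp only [Finset.coe_filter, Finset.mem_univ, true_and, Set.mem_ofPred_eq] at h
    rw [hasDualType_borderCol] at h
    simp only [Finset.coe_range, Set.mem_Iio]
    by_contra! hle
    have := hL _ hle
    omega

end Counting

theorem exists_descent {m L : ℕ} {c : ℕ → ℕ} (hL : ∀ k, L ≤ k → c k = 0)
    (hsum : ∑ k ∈ Finset.range L, c k = m + 1) : ∃ j ∈ Finset.range L, c (j + 1) < c j := by
  by_contra! h
  have hmono : ∀ k ≤ L, ∀ i ≤ k, c i ≤ c k := by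
    intro k
    induction k with
    | zero => intro _ i hi; rw [Nat.le_zero.1 hi]
    | succ k ih =>
      intro hk i hi
      rcases Nat.le_succ_iff.1 hi with hi | rfl
      · exact (ih (by omega) i hi).trans (h k (Finset.mem_range.2 (by omega)))
      · exact le_rfl
  have hzero : ∑ k ∈ Finset.range L, c k = 0 := by
    refine Finset.sum_eq_zero fun k hk => ?_
    have := hmono L le_rfl k (Finset.mem_range.1 hk).le
    rw [hL L le_rfl] at this
    omega
  omega

theorem sum_range_update_pred {L j : ℕ} {c : ℕ → ℕ} (hj : j < L) (hc : 1 ≤ c j) :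
    ∑ k ∈ Finset.range L, Function.update c j (c j - 1) k + 1 = ∑ k ∈ Finset.range L, c k := by
  have hmem := Finset.mem_range.2 hj
  rw [Finset.sum_update_of_mem hmem, Finset.sum_eq_add_sum_sdiff_singleton_of_mem hmem c]
  omega

/-- The polynomial `borderPoly` is divisible by `X - 1` exactly once, unless `j = 0`. -/
theorem exists_borderPoly_eq {m j : ℕ} {c : ℕ → ℕ} (hc : Antitone c) (hj : 1 ≤ c j)
    (hm : c 0 ≤ m ∨ j = 0) (hm' : c 0 ≤ m + 1) :
    ∃ S : ℤ[X], 0 < S.eval 1 ∧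
      (X - 1) ^ (m - Function.update c j (c j - 1) 0) * borderPoly m c j =
        (X - 1) ^ (m + 1 - c 0) * S := by
  rcases j with _ | j
  · refine ⟨X ^ (m + 1 - c 0), by simp, ?_⟩
    rw [Function.update_self, show m - (c 0 - 1) = m + 1 - c 0 by omega]
    simp [borderPoly]
  · have hm0 : c 0 ≤ m := by simpa using hm
    have h1 : c (j + 1) ≤ c j := hc (Nat.le_succ j)
    have h2 : c j ≤ c 0 := hc (Nat.zero_le j)
    refine ⟨X ^ (m - c j) * ∑ i ∈ Finset.range (c j - c (j + 1) + 1), X ^ i, ?_, ?_⟩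
    · simp [eval_finsetSum]
    · rw [Function.update_of_ne (by omega), show m + 1 - c 0 = (m - c 0) + 1 by omega, pow_succ,
        mul_assoc]
      congr 1
      rw [mul_left_comm, mul_geom_sum, mul_sub, ← pow_add]
      simp only [borderPoly, Nat.add_sub_cancel, Nat.add_eq_zero_iff, one_ne_zero, and_false,
        if_false, mul_one]
      congr 2
      omega

theorem dualCount_zero {F : Type} [Field F] {d : ℕ → ℕ} (hd : ∀ k, d k = 0) :
    dualCount 0 d F = 1 := by
  rw [dualCount, Nat.card_eq_one_iff_unique]
  refine ⟨inferInstance, ⟨0, fun i => i.elim0, fun k => ?_⟩⟩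
  rw [hd, Subsingleton.elim ((0 : Matrix (Fin 0) (Fin 0) F) ^ k) (0 ^ (k + 1)), add_zero]

theorem exists_dualCount_eq_eval (L m : ℕ) : ∀ c : ℕ → ℕ, Antitone c → (∀ k, L ≤ k → c k = 0) →
    ∑ k ∈ Finset.range L, c k = m → ∃ R : ℤ[X], 0 < R.eval 1 ∧
      ∀ (F : Type) [Field F] [Fintype F],
        (dualCount m c F : ℤ) = ((X - 1) ^ (m - c 0) * R).eval (Fintype.card F : ℤ) := by
  induction m with
  | zero =>
    intro c _ hL hsum
    have hzero : ∀ k, c k = 0 := fun k => by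
      by_cases hk : L ≤ k
      · exact hL k hk
      · exact Finset.sum_eq_zero_iff.1 hsum k (Finset.mem_range.2 (not_le.1 hk))
    exact ⟨1, by simp, fun F _ _ => by simp [dualCount_zero hzero]⟩
  | succ m ih =>
    intro c hc hL hsum
    have key : ∀ j, ∃ R : ℤ[X], 0 ≤ R.eval 1 ∧ (j < L → c (j + 1) < c j → 0 < R.eval 1) ∧
        (j < L → ∀ (F : Type) [Field F] [Fintype F],
          (if 1 ≤ c j then (borderPoly m c j).eval (Fintype.card F : ℤ) *
            (dualCount m (Function.update c j (c j - 1)) F : ℤ) else 0) =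
          ((X - 1) ^ (m + 1 - c 0) * R).eval (Fintype.card F : ℤ)) := by
      intro j
      by_cases hj : j < L ∧ c (j + 1) < c j
      · obtain ⟨hjL, hjc⟩ := hj
        have hcj : 1 ≤ c j := by omega
        have hanti : Antitone (Function.update c j (c j - 1)) := by
          refine antitone_nat_of_succ_le fun k => ?_
          have := hc (Nat.le_add_right k 1)
          simp only [Function.update_apply]
          split_ifs <;> subst_vars <;> omega
        obtain ⟨R, hR, hRF⟩ := ih _ hanti (fun k hk => by
            rw [Function.update_of_ne (by omega)]; exact hL k hk)
          (by have := sum_range_update_pred hjL hcj; omega)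
        have h0 : c 0 ≤ m + 1 := hsum ▸
          Finset.single_le_sum (f := c) (fun _ _ => Nat.zero_le _) (Finset.mem_range.2 (by omega))
        have h0' : c 0 ≤ m ∨ j = 0 := by
          by_cases hj0 : j = 0
          · exact Or.inr hj0
          · left
            have := Finset.sum_le_sum_of_subset (f := c) (s := {0, j}) (t := Finset.range L) (by
              intro x; simp; omega)
            rw [Finset.sum_pair (Ne.symm hj0)] at this
            omega
        obtain ⟨S, hS, hSeq⟩ := exists_borderPoly_eq hc hcj h0' h0
        refine ⟨S * R, ?_, ?_, fun _ F _ _ => ?_⟩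
        · rw [eval_mul]; positivity
        · intro _ _; rw [eval_mul]; positivity
        · rw [if_pos hcj, hRF, ← eval_mul, ← mul_assoc, ← mul_assoc, ← hSeq,
            mul_comm (borderPoly m c j)]
      · refine ⟨0, by simp, fun h1 h2 => absurd ⟨h1, h2⟩ hj, fun hjL F _ _ => ?_⟩
        split_ifs with hcj
        · rw [dualCount_eq_zero]
          · simp
          · intro hanti
            have := hanti (Nat.le_succ j)
            rw [Function.update_self, Nat.succ_eq_add_one, Function.update_of_ne (by omega)] at this
            exact hj ⟨hjL, by omega⟩
        · simp
    choose R hR0 hR1 hRF using key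
    obtain ⟨j, hjL, hjc⟩ := exists_descent hL hsum
    refine ⟨∑ j ∈ Finset.range L, R j, ?_, fun F _ _ => ?_⟩
    · rw [eval_finsetSum]
      exact Finset.sum_pos' (fun i _ => hR0 i) ⟨j, hjL, hR1 j (Finset.mem_range.1 hjL) hjc⟩
    · rw [dualCount_succ c L hL, Finset.mul_sum, eval_finsetSum]
      exact Finset.sum_congr rfl fun j hj => hRF j (Finset.mem_range.1 hj) F

theorem sum_sub_eq_add_dualPart (f : ℕ → ℕ) (N k : ℕ) :
    ∑ i ∈ Finset.Icc 1 N, (f i - k) =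
      ∑ i ∈ Finset.Icc 1 N, (f i - (k + 1)) + dualPart f N (k + 1) := by
  rw [dualPart, Finset.card_filter, ← Finset.sum_add_distrib]
  refine Finset.sum_congr rfl fun i _ => ?_
  split_ifs <;> omega

theorem hasJordanType_iff_hasDualType {m N : ℕ} {F : Type} [Field F]
    (A : Matrix (Fin m) (Fin m) F) (f : ℕ → ℕ) (hf : ∑ i ∈ Finset.Icc 1 N, f i = m) :
    HasJordanType A f N ↔ HasDualType A fun k => dualPart f N (k + 1) := by
  constructor
  · intro h k
    rw [h k, h (k + 1), sum_sub_eq_add_dualPart]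
  · intro h k
    induction k with
    | zero => simp [hf]
    | succ k ih =>
      have h1 := h k
      rw [ih, sum_sub_eq_add_dualPart] at h1
      exact (Nat.add_right_cancel h1).symm

theorem sum_range_dualPart (f : ℕ → ℕ) (N L : ℕ) :
    ∑ k ∈ Finset.range L, dualPart f N (k + 1) + ∑ i ∈ Finset.Icc 1 N, (f i - L) =
      ∑ i ∈ Finset.Icc 1 N, f i := by
  induction L with
  | zero => simp
  | succ L ih =>
    rw [← ih, Finset.sum_range_succ, sum_sub_eq_add_dualPart f N L]
    ring

theorem IsPartitionFun.exists_jordanCount_eq_eval {n N : ℕ} {f : ℕ → ℕ}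
    (hf : IsPartitionFun f n N) : ∃ R : ℤ[X], 0 < R.eval 1 ∧
      ∀ (F : Type) [Field F] [Fintype F],
        (jordanCount n f N F : ℤ) = ((X - 1) ^ (n - N) * R).eval (Fintype.card F : ℤ) := by
  obtain ⟨hanti, hpos, hsum⟩ := hf
  have hle : ∀ k, f 0 ≤ k → ∀ i, f i ≤ k := fun k hk i => (hanti 0 i (Nat.zero_le i)).trans hk
  have hN : dualPart f N (0 + 1) = N := by
    rw [dualPart, Finset.filter_true_of_mem, Nat.card_Icc, Nat.add_sub_cancel]
    intro i hi
    obtain ⟨h1, h2⟩ := Finset.mem_Icc.1 hi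
    exact (hpos i h1).2 h2
  obtain ⟨R, hR, hRF⟩ := exists_dualCount_eq_eval (f 0) n (fun k => dualPart f N (k + 1))
    (fun a b hab => Finset.card_le_card
      (Finset.monotone_filter_right _ fun i _ hi => (Nat.succ_le_succ hab).trans hi))
    (fun k hk => by
      rw [dualPart, Finset.card_eq_zero, Finset.filter_eq_empty_iff]
      intro i _
      have := hle k hk i
      omega)
    (by
      rw [← hsum, ← sum_range_dualPart f N (f 0), Finset.sum_eq_zero (s := Finset.Icc 1 N),
        add_zero]
      intro i _
      exact Nat.sub_eq_zero_of_le (hle _ le_rfl i))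
  refine ⟨R, hR, fun F _ _ => ?_⟩
  rw [hN] at hRF
  rw [← hRF, jordanCount, dualCount]
  simp only [hasJordanType_iff_hasDualType _ f hsum]

theorem Polynomial.eq_of_eval_prime_eq {P Q : ℤ[X]}
    (h : ∀ p : ℕ, p.Prime → P.eval (p : ℤ) = Q.eval (p : ℤ)) : P = Q := by
  refine Polynomial.eq_of_infinite_eval_eq P Q
    ((Nat.infinite_setOfPred_prime.image Nat.cast_injective.injOn).mono ?_)
  rintro _ ⟨p, hp, rfl⟩
  exact h p hp

theorem multiplicity_of_one (n N : ℕ) (f : ℕ → ℕ) (hf : IsPartitionFun f n N)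
    (P : Polynomial ℤ)
    (hP : ∀ (F : Type) [Field F] [Fintype F],
      (jordanCount n f N F : ℤ) = P.eval (Fintype.card F : ℤ)) :
    P.rootMultiplicity 1 = n - N ∧
      (X - 1 : Polynomial ℤ) ^ (n - N) ∣ P ∧
      ¬ (X - 1 : Polynomial ℤ) ^ (n - N + 1) ∣ P := by
  obtain ⟨R, hR, hRF⟩ := hf.exists_jordanCount_eq_eval
  have hPR : P = (X - 1) ^ (n - N) * R := Polynomial.eq_of_eval_prime_eq fun p hp => by
    have : Fact p.Prime := ⟨hp⟩
    have h := hP (ZMod p)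
    rwa [hRF, ZMod.card, eq_comm] at h
  have hX : (X - 1 : ℤ[X]) ^ (n - N) ≠ 0 := pow_ne_zero _ (X_sub_C_ne_zero 1)
  have hne : P ≠ 0 := by
    rw [hPR]
    refine mul_ne_zero hX ?_
    rintro rfl
    simp at hR
  have hdvd : (X - 1 : ℤ[X]) ^ (n - N) ∣ P := ⟨R, hPR⟩
  have hndvd : ¬ (X - 1 : ℤ[X]) ^ (n - N + 1) ∣ P := by
    rw [hPR, pow_succ, mul_dvd_mul_iff_left hX]
    intro h
    exact hR.ne' (dvd_iff_isRoot.1 h)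
  refine ⟨le_antisymm ?_ ?_, hdvd, hndvd⟩
  · by_contra! hlt
    exact hndvd (by simpa using (le_rootMultiplicity_iff hne).1 (Nat.succ_le_of_lt hlt))
  · exact (le_rootMultiplicity_iff hne).2 (by simpa using hdvd)
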